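/- Comparison of determining wavenumbers in the subcritical range (Lemma on passing to the endpoint exponent): let 1 < α < 2, ν > 0, L > 0, c₀ > 0, and set λ_q = 2^q/L, r₀ = 4/(α−1), and c_{α,r} = c₀(α−1)²(1 − 2^{(α−1)/2 − 2/r})^{2α/(α−1)} for r ∈ (2α/(α−1), r₀). For a family (θ_p)_{p≥−1} of bounded measurable functions on 𝕋² = (ℝ/(Lℤ))² and r in this range, define Λ_r as the least λ_q (q ≥ −1) such that λ_p^{1−α+2/r}‖θ_p‖_{L^r} < c_{α,r}ν for all p > q and λ_q^{−α} ∑_{p≤q} λ_p ‖θ_p‖_{L^∞} < c_{α,r}ν, and define Λ̄_r as the least λ_q such that λ_p^{(1−α)/2}‖θ_p‖_{L^{r₀}} < c_{α,r}ν/2 for all p > q and λ_q^{−α} ∑_{p≤q} λ_p ‖θ_p‖_{L^∞} < c_{α,r}ν (each set to +∞ if no such q exists). Then for every M > 0 there exists r ∈ (2α/(α−1), r₀), depending only on M, α, ν, L, c₀, such that for every family (θ_p)_{p≥−1} with sup_{p≥−1} ‖θ_p‖_{L^∞(𝕋²)} ≤ M, one has Λ_r ≤ Λ̄_r. -/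

import Mathlib

open MeasureTheory Complex Real
open scoped ENNReal

noncomputable section

/-- The dyadic wavenumber `λ_q = 2^q/L`. -/
def lamq (L : ℝ) (q : ℤ) : ℝ := 2 ^ q / L

/-- The constant `c_{α,r} = c₀ (α−1)² (1 − 2^{(α−1)/2 − 2/r})^{2α/(α−1)}` of the subcritical
regime. -/
def cSub (c₀ α r : ℝ) : ℝ :=
  c₀ * (α - 1) ^ 2 * (1 - 2 ^ ((α - 1) / 2 - 2 / r)) ^ (2 * α / (α - 1))

/-- The low-mode condition `λ_q^{−α} ∑_{−1 ≤ p ≤ q} λ_p ‖θ_p‖_{L^∞} < c_{α,r} ν`. -/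
def lowCond (L : ℝ) [Fact (0 < L)] (ν α c₀ r : ℝ)
    (θ : ℤ → AddCircle L × AddCircle L → ℝ) (q : ℤ) : Prop :=
  ENNReal.ofReal (lamq L q ^ (-α)) *
      ∑ p ∈ Finset.Icc (-1 : ℤ) q, ENNReal.ofReal (lamq L p) * eLpNorm (θ p) ⊤ volume
    < ENNReal.ofReal (cSub c₀ α r * ν)

/-- The high-mode condition `λ_p^{1−α+2/r} ‖θ_p‖_{L^r} < c_{α,r} ν` for all `p > q`. -/
def highCond (L : ℝ) [Fact (0 < L)] (ν α c₀ r : ℝ)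
    (θ : ℤ → AddCircle L × AddCircle L → ℝ) (q : ℤ) : Prop :=
  ∀ p : ℤ, q < p →
    ENNReal.ofReal (lamq L p ^ (1 - α + 2 / r)) * eLpNorm (θ p) (ENNReal.ofReal r) volume
      < ENNReal.ofReal (cSub c₀ α r * ν)

/-- The endpoint high-mode condition `λ_p^{(1−α)/2} ‖θ_p‖_{L^{4/(α−1)}} < c_{α,r} ν / 2`
for all `p > q`. -/
def highCondBar (L : ℝ) [Fact (0 < L)] (ν α c₀ r : ℝ)
    (θ : ℤ → AddCircle L × AddCircle L → ℝ) (q : ℤ) : Prop :=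
  ∀ p : ℤ, q < p →
    ENNReal.ofReal (lamq L p ^ ((1 - α) / 2)) *
        eLpNorm (θ p) (ENNReal.ofReal (4 / (α - 1))) volume
      < ENNReal.ofReal (cSub c₀ α r * ν / 2)

/-- The determining wavenumber `Λ_r`: the least `λ_q`, `q ≥ −1`, satisfying both conditions
(`+∞` if there is none). -/
def detWavenumber (L : ℝ) [Fact (0 < L)] (ν α c₀ r : ℝ)
    (θ : ℤ → AddCircle L × AddCircle L → ℝ) : ℝ≥0∞ :=
  sInf {x : ℝ≥0∞ | ∃ q : ℤ, -1 ≤ q ∧ highCond L ν α c₀ r θ q ∧ lowCond L ν α c₀ r θ q ∧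
    x = ENNReal.ofReal (lamq L q)}

/-- The endpoint determining wavenumber `Λ̄_r`, built from the `L^{4/(α−1)}` norm. -/
def detWavenumberBar (L : ℝ) [Fact (0 < L)] (ν α c₀ r : ℝ)
    (θ : ℤ → AddCircle L × AddCircle L → ℝ) : ℝ≥0∞ :=
  sInf {x : ℝ≥0∞ | ∃ q : ℤ, -1 ≤ q ∧ highCondBar L ν α c₀ r θ q ∧ lowCond L ν α c₀ r θ q ∧
    x = ENNReal.ofReal (lamq L q)}

/-- Negative exponentials in `1 / δ` are eventually beaten by powers of `δ` as `δ → 0⁺`. -/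
lemma eventually_mul_two_rpow_neg_div_lt (A b C k : ℝ) (hb : 0 < b) (hC : 0 < C) :
    ∀ᶠ δ in nhdsWithin (0 : ℝ) (Set.Ioi 0),
      A * (2 : ℝ) ^ (-(b / δ)) < C * (δ / 2) ^ k := by
  have hlog : 0 < Real.log 2 * b := mul_pos (Real.log_pos one_lt_two) hb
  have h1 := ((tendsto_rpow_mul_exp_neg_mul_atTop_nhds_zero k _ hlog).const_mul
    (A * 2 ^ k)).comp tendsto_inv_nhdsGT_zero
  rw [mul_zero] at h1
  filter_upwards [h1.eventually_lt_const hC, self_mem_nhdsWithin] with δ h hδ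
  have hδ : 0 < δ := hδ
  simp only [Function.comp] at h
  have hpos : 0 < (δ / 2) ^ k := by positivity
  have hinv : 2 ^ k * δ⁻¹ ^ k * (δ / 2) ^ k = 1 := by
    rw [← Real.mul_rpow (by positivity) (by positivity),
      ← Real.mul_rpow (by positivity) (by positivity)]
    rw [show 2 * δ⁻¹ * (δ / 2) = 1 by field_simp, Real.one_rpow]
  have hexp : (2 : ℝ) ^ (-(b / δ)) = Real.exp (-(Real.log 2 * b) * δ⁻¹) := by
    rw [Real.rpow_def_of_pos two_pos]
    congr 1
    field_simp
  rw [hexp]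
  calc A * Real.exp (-(Real.log 2 * b) * δ⁻¹)
      = A * 2 ^ k * (δ⁻¹ ^ k * Real.exp (-(Real.log 2 * b) * δ⁻¹)) * (δ / 2) ^ k := by
        linear_combination (-A * Real.exp (-(Real.log 2 * b) * δ⁻¹)) * hinv
    _ < C * (δ / 2) ^ k := by gcongr

lemma half_le_one_sub_two_rpow_neg {δ : ℝ} (h0 : 0 ≤ δ) (h1 : δ ≤ 1) :
    δ / 2 ≤ 1 - (2 : ℝ) ^ (-δ) := by
  have h := _root_.rpow_one_add_le_one_add_mul_self (s := -(1 / 2)) (by norm_num) h0 h1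
  rw [show (1 : ℝ) + -(1 / 2) = 2⁻¹ by norm_num, Real.inv_rpow zero_le_two,
    ← Real.rpow_neg zero_le_two] at h
  linarith

lemma lamq_pos {L : ℝ} (hL : 0 < L) (q : ℤ) : 0 < lamq L q := by
  unfold lamq
  positivity

lemma lamq_mul {L : ℝ} (hL : 0 < L) (q : ℤ) : lamq L q * L = 2 ^ (q : ℝ) := by
  rw [lamq, div_mul_cancel₀ _ hL.ne', Real.rpow_intCast]

lemma lamq_rpow_mul_rpow {L : ℝ} (hL : 0 < L) (q : ℤ) (x : ℝ) :
    lamq L q ^ x * L ^ x = 2 ^ (q * x) := by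
  rw [← Real.mul_rpow (lamq_pos hL q).le hL.le, lamq_mul hL, ← Real.rpow_mul zero_le_two]

lemma volume_univ_torus_rpow (L : ℝ) [hL : Fact (0 < L)] (x : ℝ) :
    (volume (Set.univ : Set (AddCircle L × AddCircle L))) ^ x = ENNReal.ofReal (L ^ (2 * x)) := by
  have hL := hL.out
  rw [← Set.univ_prod_univ, Measure.volume_eq_prod, Measure.prod_prod, AddCircle.measure_univ,
    ← ENNReal.ofReal_mul hL.le, ENNReal.ofReal_rpow_of_pos (by positivity), ← pow_two,
    Real.rpow_mul hL.le, Real.rpow_two]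

/-- Hölder's inequality on the torus, weighted by a power of a dyadic wavenumber. -/
lemma lamq_rpow_mul_eLpNorm_le (L : ℝ) [hL : Fact (0 < L)] {θ : AddCircle L × AddCircle L → ℝ}
    (hθ : Measurable θ) {p q : ℝ≥0∞} (hpq : p ≤ q) (n : ℤ) (a : ℝ) {δ : ℝ}
    (hδ : 2 * (1 / p.toReal - 1 / q.toReal) = δ) :
    ENNReal.ofReal (lamq L n ^ (a + δ)) * eLpNorm θ p volume ≤
      ENNReal.ofReal (2 ^ (n * δ)) * (ENNReal.ofReal (lamq L n ^ a) * eLpNorm θ q volume) := by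
  have hl := lamq_pos hL.out n
  calc ENNReal.ofReal (lamq L n ^ (a + δ)) * eLpNorm θ p volume
      ≤ ENNReal.ofReal (lamq L n ^ (a + δ)) * (eLpNorm θ q volume * ENNReal.ofReal (L ^ δ)) := by
        gcongr
        rw [← hδ, ← volume_univ_torus_rpow]
        exact eLpNorm_le_eLpNorm_mul_rpow_measure_univ hpq hθ.aestronglyMeasurable
    _ = _ := by
        rw [← lamq_rpow_mul_rpow hL.out, Real.rpow_add hl, ENNReal.ofReal_mul (by positivity),
          ENNReal.ofReal_mul (by positivity)]
        ring

lemma highCond_of_highCondBar {α ν c₀ L M δ r : ℝ} [hL : Fact (0 < L)] (hα1 : 1 < α)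
    (hM : 0 < M) (hδ : 0 < δ) (hδα : δ ≤ (α - 1) / 4)
    (hr0 : 0 < r) (hr : 2 / r = (α - 1) / 2 + δ)
    (hsmall : M * L ^ (α - 1) * 2 ^ (-((α - 1) / 4 / δ)) < cSub c₀ α r * ν)
    {θ : ℤ → AddCircle L × AddCircle L → ℝ} (hθ : ∀ p, Measurable (θ p))
    (hθM : ∀ p : ℤ, -1 ≤ p → eLpNorm (θ p) ⊤ volume ≤ ENNReal.ofReal M)
    {q : ℤ} (hq : -1 ≤ q) (h : highCondBar L ν α c₀ r θ q) : highCond L ν α c₀ r θ q := by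
  have hL' := hL.out
  have hα : 0 < α - 1 := by linarith
  intro p hp
  by_cases hpδ : (p : ℝ) * δ ≤ 1
  · have hle : r ≤ 4 / (α - 1) := by
      rw [le_div_iff₀ hα]
      rw [div_eq_iff hr0.ne'] at hr
      nlinarith
    have hH := lamq_rpow_mul_eLpNorm_le L (hθ p) (ENNReal.ofReal_le_ofReal hle) p
      ((1 - α) / 2) (δ := δ) (by
        rw [ENNReal.toReal_ofReal hr0.le, ENNReal.toReal_ofReal (by positivity), mul_sub,
          mul_one_div, hr]
        field_simp
        ring)
    rw [show 1 - α + 2 / r = (1 - α) / 2 + δ by rw [hr]; ring]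
    have h2 : (2 : ℝ) ^ (p * δ) ≤ 2 := by
      simpa using Real.rpow_le_rpow_of_exponent_le one_le_two hpδ
    calc _ ≤ _ := hH
      _ ≤ ENNReal.ofReal 2 * (ENNReal.ofReal (lamq L p ^ ((1 - α) / 2)) *
          eLpNorm (θ p) (ENNReal.ofReal (4 / (α - 1))) volume) := by gcongr
      _ < ENNReal.ofReal 2 * ENNReal.ofReal (cSub c₀ α r * ν / 2) :=
          ENNReal.mul_lt_mul_right (by simp) (by simp) (h p hp)
      _ = _ := by rw [← ENNReal.ofReal_mul zero_le_two]; congr 1; ring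
  · have hH := lamq_rpow_mul_eLpNorm_le L (hθ p) (le_top (a := ENNReal.ofReal r)) p
      (1 - α) (δ := 2 / r) (by simp [ENNReal.toReal_ofReal hr0.le, div_eq_mul_inv])
    have hl := lamq_pos hL' p
    have hp1 : 1 / δ < p := by
      rw [div_lt_iff₀ hδ]
      linarith
    have hexp : (p : ℝ) * (1 - α + 2 / r) ≤ -((α - 1) / 4 / δ) := by
      have h1 : (α - 1) / 4 / δ ≤ (α - 1) / 4 * p := by
        rw [div_eq_mul_one_div _ δ]
        gcongr
      have h2 : (0 : ℝ) < p := lt_trans (by positivity) hp1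
      rw [hr]
      nlinarith
    have hid : (2 : ℝ) ^ (p * (2 / r)) * lamq L p ^ (1 - α) =
        L ^ (α - 1) * 2 ^ ((p : ℝ) * (1 - α + 2 / r)) := by
      have h3 := lamq_rpow_mul_rpow hL' p (1 - α)
      have h4 : L ^ (1 - α) * L ^ (α - 1) = 1 := by
        rw [← Real.rpow_add hL']
        simp
      rw [mul_add, Real.rpow_add two_pos, ← h3]
      linear_combination (-(2 : ℝ) ^ (p * (2 / r)) * lamq L p ^ (1 - α)) * h4
    calc _ ≤ _ := hH
      _ ≤ ENNReal.ofReal (2 ^ (p * (2 / r))) *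
          (ENNReal.ofReal (lamq L p ^ (1 - α)) * ENNReal.ofReal M) := by
        gcongr
        exact hθM p (by lia)
      _ = ENNReal.ofReal (M * L ^ (α - 1) * 2 ^ ((p : ℝ) * (1 - α + 2 / r))) := by
        rw [← ENNReal.ofReal_mul (by positivity), ← ENNReal.ofReal_mul (by positivity)]
        congr 1
        linear_combination M * hid
      _ < _ := by
        refine (ENNReal.ofReal_lt_ofReal_iff_of_nonneg (by positivity)).2 (lt_of_le_of_lt ?_ hsmall)
        gcongr
        exact one_le_two

/-- **Comparison of determining wavenumbers in the subcritical range.**  Let `1 < α < 2`,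
`ν > 0`, `L > 0`, `c₀ > 0`.  For every `M > 0` there exists `r ∈ (2α/(α−1), 4/(α−1))`,
depending only on `M, α, ν, L, c₀`, such that for every family `(θ_p)_{p≥−1}` of bounded
measurable functions on `𝕋²` with `sup_{p≥−1} ‖θ_p‖_{L^∞} ≤ M`, one has `Λ_r ≤ Λ̄_r`. -/
theorem detWavenumber_le_endpoint (α ν c₀ : ℝ) (L : ℝ) [Fact (0 < L)]
    (hα1 : 1 < α) (hα2 : α < 2) (hν : 0 < ν) (hc₀ : 0 < c₀) (M : ℝ) (hM : 0 < M) :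
    ∃ r : ℝ, 2 * α / (α - 1) < r ∧ r < 4 / (α - 1) ∧
      ∀ θ : ℤ → AddCircle L × AddCircle L → ℝ,
        (∀ p : ℤ, Measurable (θ p)) →
        (∀ p : ℤ, -1 ≤ p → eLpNorm (θ p) ⊤ volume ≤ ENNReal.ofReal M) →
        detWavenumber L ν α c₀ r θ ≤ detWavenumberBar L ν α c₀ r θ := by
  have hα : 0 < α - 1 := by linarith
  have hβ : 0 < (α - 1) / α - (α - 1) / 2 := sub_pos.2 (by gcongr)
  have hC : 0 < c₀ * (α - 1) ^ 2 * ν := by positivity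
  obtain ⟨δ, hs, ⟨hδ, hδβ⟩, -, hδα⟩ := ((eventually_mul_two_rpow_neg_div_lt (M * L ^ (α - 1))
    ((α - 1) / 4) _ (2 * α / (α - 1)) (by positivity) hC).and
      (Filter.inter_mem (Ioo_mem_nhdsGT hβ)
        (Ioo_mem_nhdsGT (show 0 < (α - 1) / 4 by positivity)))).exists
  set r := 2 / ((α - 1) / 2 + δ) with hrdef
  have hr0 : 0 < r := by positivity
  have hr : 2 / r = (α - 1) / 2 + δ := by rw [hrdef, div_div_cancel₀ two_ne_zero]
  refine ⟨r, ?_, ?_, fun θ hθ hθM ↦ sInf_le_sInf ?_⟩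
  · rw [hrdef, lt_div_iff₀ (by positivity)]
    calc 2 * α / (α - 1) * ((α - 1) / 2 + δ) < 2 * α / (α - 1) * ((α - 1) / α) := by
          gcongr
          linarith
      _ = 2 := by field_simp
  · rw [hrdef, div_lt_div_iff₀ (by positivity) hα]
    linarith
  · rintro x ⟨q, hq, hbar, hlow, rfl⟩
    refine ⟨q, hq, highCond_of_highCondBar hα1 hM hδ hδα.le hr0 hr (hs.trans_le ?_) hθ hθM hq hbar,
      hlow, rfl⟩
    rw [cSub, hr, show (α - 1) / 2 - ((α - 1) / 2 + δ) = -δ by ring, mul_right_comm]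
    have := half_le_one_sub_two_rpow_neg hδ.le (show δ ≤ 1 by linarith)
    gcongr
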